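/- Let k be an algebraically closed field and n a positive integer. Then the special linear group SL_n(k) has only finitely many z-classes, i.e. the set of equivalence classes of SL_n(k) under z-equivalence is finite. -/

import Mathlib

/-- Two elements of a group are *z-equivalent* if their centralizers are conjugate:
there is `a` with `a ⬝ Z(g) ⬝ a⁻¹ = Z(h)`. -/
def IsZEquiv {G : Type*} [Group G] (g h : G) : Prop :=
  ∃ a : G, ∀ x : G, x ∈ Subgroup.centralizer {g} ↔ a * x * a⁻¹ ∈ Subgroup.centralizer {h}

section JordanForm

open Polynomial Module Matrix
open scoped DirectSum

/-- The powers of `X - μ` form a basis of `k[X] / ((X - μ) ^ e)`. -/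
theorem exists_basis_quotient_X_sub_C_pow {k : Type*} [Field k] (μ : k) (e : ℕ) :
    ∃ b : Basis (Fin e) k (k[X] ⧸ Ideal.span {(X - C μ) ^ e}),
      ∀ j, b j = Ideal.Quotient.mk _ ((X - C μ) ^ (j : ℕ)) := by
  have hmonic : ((X - C μ) ^ e).Monic := (monic_X_sub_C μ).pow e
  let y : AdjoinRoot ((X - C μ) ^ e) := AdjoinRoot.root _ - algebraMap k _ μ
  have hmin : minpoly k y = X ^ e := by
    rw [minpoly.sub_algebraMap, AdjoinRoot.minpoly_root hmonic.ne_zero, hmonic.leadingCoeff]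
    simp
  have hdeg : (minpoly k y).natDegree = e := by rw [hmin, natDegree_X_pow]
  have hli : LinearIndependent k fun j : Fin e => y ^ (j : ℕ) := by
    have := linearIndependent_pow (K := k) y
    rwa [hdeg] at this
  have : FiniteDimensional k (AdjoinRoot ((X - C μ) ^ e)) :=
    (AdjoinRoot.powerBasis' hmonic).finite
  have hcard : Fintype.card (Fin e) = finrank k (AdjoinRoot ((X - C μ) ^ e)) := by
    rw [(AdjoinRoot.powerBasis' hmonic).finrank, AdjoinRoot.powerBasis'_dim]
    simp
  let B : Basis (Fin e) k (AdjoinRoot ((X - C μ) ^ e)) :=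
    basisOfLinearIndependentOfCardEqFinrank' _ hli hcard
  refine ⟨B, fun j => ?_⟩
  have h1 : B j = y ^ (j : ℕ) := by simp [B]
  have h2 : y = AdjoinRoot.mk _ (X - C μ) := by
    simp [y, AdjoinRoot.algebraMap_eq]
  rw [h2, ← map_pow] at h1
  exact h1

/-- Every endomorphism of a finite-dimensional space over an algebraically closed field has a
Jordan basis, the union of
Jordan chains `v i 0, …, v i (e i - 1)`. -/
theorem exists_jordan_chain_basis.{u, v} {k : Type u} {V : Type v} [Field k] [IsAlgClosed k]
    [AddCommGroup V] [Module k V] [FiniteDimensional k V] (f : End k V) :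
    ∃ (ι : Type u) (_ : Fintype ι) (e : ι → ℕ) (μ : ι → k) (v : ι → ℕ → V)
      (b : Basis (Σ i, Fin (e i)) k V), (∀ i j, b ⟨i, j⟩ = v i j) ∧
      (∀ i j, f (v i j) = μ i • v i j + v i (j + 1)) ∧ ∀ i j, e i ≤ j → v i j = 0 := by
  classical
  obtain ⟨ι, hι, p, hp, e, ⟨φ⟩⟩ := Module.equiv_directSum_of_isTorsion
    (Module.AEval.isTorsion_of_finiteDimensional k V f)
  have hroot (i : ι) : ∃ μ : k, Ideal.span {p i ^ e i} = Ideal.span {(X - C μ) ^ e i} := by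
    obtain ⟨μ, hμ⟩ := IsAlgClosed.exists_root (p i) (degree_pos_of_irreducible (hp i)).ne'
    refine ⟨μ, Ideal.span_singleton_eq_span_singleton.2 (Associated.pow_pow ?_)⟩
    exact ((irreducible_X_sub_C μ).associated_of_dvd (hp i) (dvd_iff_isRoot.2 hμ)).symm
  choose μ hμ using hroot
  let ψ (i : ι) := Submodule.quotEquivOfEq _ _ (hμ i)
  choose B hB using fun i => exists_basis_quotient_X_sub_C_pow (μ i) (e i)
  let Ψ : AEval k V f ≃ₗ[k[X]] Π₀ i, k[X] ⧸ Ideal.span {(X - C (μ i)) ^ e i} :=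
    φ.trans (DFinsupp.mapRange.linearEquiv ψ)
  let Ψk : V ≃ₗ[k] Π₀ i, k[X] ⧸ Ideal.span {(X - C (μ i)) ^ e i} :=
    (AEval.of k V f).trans (Ψ.restrictScalars k)
  let w (i : ι) (j : ℕ) : Π₀ i, k[X] ⧸ Ideal.span {(X - C (μ i)) ^ e i} :=
    DFinsupp.single i (Ideal.Quotient.mk _ ((X - C (μ i)) ^ j))
  have hw (i : ι) (j : ℕ) : (X : k[X]) • w i j = μ i • w i j + w i (j + 1) := by
    have key : (X : k[X]) * (X - C (μ i)) ^ j =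
        μ i • (X - C (μ i)) ^ j + (X - C (μ i)) ^ (j + 1) := by
      rw [smul_eq_C_mul]
      ring
    simp only [w, ← DFinsupp.single_smul, ← DFinsupp.single_add]
    exact congrArg (DFinsupp.single i) (congrArg (Ideal.Quotient.mk _) key)
  have hX (x : V) : Ψk (f x) = (X : k[X]) • Ψk x := by
    change Ψ (AEval.of k V f (f x)) = X • Ψ (AEval.of k V f x)
    rw [← map_smul, AEval.X_smul_of]
    rfl
  refine ⟨ι, hι, e, μ, fun i j => Ψk.symm (w i j), (DFinsupp.basis B).map Ψk.symm, ?_, ?_, ?_⟩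
  · intro i j
    simp [w, hB, DFinsupp.basis]
  · intro i j
    apply Ψk.injective
    rw [hX]
    simp [hw]
  · intro i j hij
    have : w i j = 0 := by
      simp only [w, DFinsupp.single_eq_zero, Ideal.Quotient.eq_zero_iff_mem,
        Ideal.mem_span_singleton]
      exact pow_dvd_pow _ hij
    simp [this]

/-- The `0`-`1` matrix of a relation. -/
noncomputable def relMatrix {ι : Type*} (k : Type*) [Field k] (r : ι → ι → Prop) :
    Matrix ι ι k :=
  open Classical in Matrix.of fun p q => if r p q then 1 else 0

theorem isNilpotent_relMatrix {ι k : Type*} [Field k] [Fintype ι] [DecidableEq ι]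
    {r : ι → ι → Prop} (w : ι → ℕ) (hw : ∀ p q, r p q → w q < w p) :
    IsNilpotent (relMatrix k r) := by
  have key (m : ℕ) : ∀ p q, (relMatrix k r ^ m) p q ≠ 0 → w q + m ≤ w p := by
    induction m with
    | zero =>
      intro p q h
      by_cases hpq : p = q
      · simp [hpq]
      · simp [hpq] at h
    | succ m ih =>
      intro p q h
      rw [pow_succ, Matrix.mul_apply] at h
      obtain ⟨t, -, ht⟩ := Finset.exists_ne_zero_of_sum_ne_zero h
      have h1 := ih p t (left_ne_zero_of_mul ht)
      have h2 : r t q := by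
        by_contra hr
        simp [relMatrix, hr] at ht
      have := hw t q h2
      omega
  refine ⟨(Finset.univ.sup w) + 1, ?_⟩
  ext p q
  by_contra h
  have h1 := key _ p q h
  have h2 : w p ≤ Finset.univ.sup w := Finset.le_sup (Finset.mem_univ p)
  omega

theorem commute_diagonal_iff {ι k : Type*} [Field k] [Fintype ι] [DecidableEq ι]
    (μ : ι → k) (x : Matrix ι ι k) :
    Commute x (diagonal μ) ↔ ∀ p q, μ p ≠ μ q → x p q = 0 := by
  rw [Commute, SemiconjBy, ← Matrix.ext_iff]
  refine forall_congr' fun p => forall_congr' fun q => ?_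
  rw [mul_diagonal, diagonal_mul, mul_comm, ← sub_eq_zero, ← sub_mul, mul_eq_zero, sub_eq_zero,
    eq_comm (a := μ q)]
  tauto

/-- A matrix commutes with the sum of commuting diagonal and nilpotent matrices if and only if it
commutes with both of them. -/
theorem commute_diagonal_add_iff {ι k : Type*} [Field k] [Fintype ι] [DecidableEq ι]
    {μ : ι → k} {N : Matrix ι ι k} (hN : IsNilpotent N) (hc : Commute N (diagonal μ))
    (x : Matrix ι ι k) :
    Commute x (diagonal μ + N) ↔ Commute x (diagonal μ) ∧ Commute x N := by
  refine ⟨fun h => ?_, fun h => h.1.add_right h.2⟩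
  suffices hx : Commute x (diagonal μ) by
    refine ⟨hx, ?_⟩
    simpa using h.sub_right hx
  let adS : End k (Matrix ι ι k) :=
    LinearMap.mulLeft k (diagonal μ) - LinearMap.mulRight k (diagonal μ)
  let adN : End k (Matrix ι ι k) := LinearMap.mulRight k N - LinearMap.mulLeft k N
  have hadN : IsNilpotent adN :=
    (LinearMap.commute_mulLeft_right N N).symm.isNilpotent_sub
      ((LinearMap.isNilpotent_mulRight_iff k N).2 hN) ((LinearMap.isNilpotent_mulLeft_iff k N).2 hN)
  have hcomm : Commute adS adN := by
    have hL : Commute (LinearMap.mulLeft k (diagonal μ)) (LinearMap.mulLeft k N) := by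
      rw [Commute, SemiconjBy, Module.End.mul_eq_comp, Module.End.mul_eq_comp,
        ← LinearMap.mulLeft_mul, ← LinearMap.mulLeft_mul, hc.eq]
    have hR : Commute (LinearMap.mulRight k (diagonal μ)) (LinearMap.mulRight k N) := by
      rw [Commute, SemiconjBy, Module.End.mul_eq_comp, Module.End.mul_eq_comp,
        ← LinearMap.mulRight_mul, ← LinearMap.mulRight_mul, hc.eq]
    exact ((LinearMap.commute_mulLeft_right _ _).sub_right hL).sub_left
      (hR.sub_right (LinearMap.commute_mulLeft_right _ _).symm)
  have hx : adS x = adN x := by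
    have := h.eq
    rw [mul_add, add_mul] at this
    simp only [adS, adN, LinearMap.sub_apply, LinearMap.mulLeft_apply, LinearMap.mulRight_apply]
    rw [sub_eq_sub_iff_add_eq_add, ← this]
    abel
  have hpow (m : ℕ) : (adS ^ m) x = (adN ^ m) x := by
    induction m with
    | zero => simp
    | succ m ih =>
      rw [pow_succ, Module.End.mul_apply, hx, ← Module.End.mul_apply, (hcomm.pow_left m).eq,
        Module.End.mul_apply, ih, ← Module.End.mul_apply, ← pow_succ']
  have hent (m : ℕ) (p q : ι) : (adS ^ m) x p q = (μ p - μ q) ^ m * x p q := by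
    induction m with
    | zero => simp
    | succ m ih =>
      rw [pow_succ', Module.End.mul_apply]
      simp only [adS, LinearMap.sub_apply, LinearMap.mulLeft_apply, LinearMap.mulRight_apply,
        Matrix.sub_apply, diagonal_mul, mul_diagonal]
      rw [ih]
      ring
  obtain ⟨m, hm⟩ := hadN
  rw [commute_diagonal_iff]
  intro p q hpq
  have h0 := hent m p q
  rw [hpow, hm] at h0
  simpa [sub_eq_zero, hpq] using h0.symm

/-- Jordan normal form: every matrix over an algebraically closed field is similar to the sum of a
diagonal matrix and a nilpotent `0`-`1` matrix commuting with it. -/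
theorem exists_jordan_form {k : Type*} [Field k] [IsAlgClosed k] {n : ℕ}
    (g : Matrix (Fin n) (Fin n) k) :
    ∃ (P : GL (Fin n) k) (μ : Fin n → k) (r : Fin n → Fin n → Prop),
      IsNilpotent (relMatrix k r) ∧ Commute (relMatrix k r) (diagonal μ) ∧
      g = P.val * (diagonal μ + relMatrix k r) * P⁻¹.val := by
  classical
  obtain ⟨ι, hι, e, μ, v, b, hb, hf, hv⟩ := exists_jordan_chain_basis (toLin' g)
  have hcard : Fintype.card (Σ i, Fin (e i)) = n := by
    rw [← finrank_eq_card_basis b]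
    simp
  let ε := Fintype.equivFinOfCardEq hcard
  let b' : Basis (Fin n) k (Fin n → k) := b.reindex ε
  let r (p q : Fin n) : Prop :=
    (ε.symm p).1 = (ε.symm q).1 ∧ ((ε.symm p).2 : ℕ) = (ε.symm q).2 + 1
  have hr (x y : Σ i, Fin (e i)) : r (ε x) (ε y) ↔ x.1 = y.1 ∧ (x.2 : ℕ) = y.2 + 1 := by
    simp only [r]
    rw [Equiv.symm_apply_apply, Equiv.symm_apply_apply]
  let s := Pi.basisFun k (Fin n)
  have hmat : LinearMap.toMatrix b' b' (toLin' g) =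
      diagonal (fun p => μ (ε.symm p).1) + relMatrix k r := by
    ext p q
    obtain ⟨⟨i, a⟩, rfl⟩ := ε.surjective p
    obtain ⟨⟨j, c⟩, rfl⟩ := ε.surjective q
    rw [LinearMap.toMatrix_apply]
    simp only [b', Basis.reindex_apply, Basis.repr_reindex_apply, Equiv.symm_apply_apply, hb, hf]
    rw [← hb, map_add, map_smul, Basis.repr_self, Finsupp.add_apply, Finsupp.smul_apply,
      Matrix.add_apply]
    congr 1
    · by_cases h : (⟨i, a⟩ : Σ i, Fin (e i)) = ⟨j, c⟩
      · simp [h]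
      · rw [Finsupp.single_eq_of_ne h, diagonal_apply_ne _ (ε.injective.ne h), smul_zero]
    · by_cases hc : (c : ℕ) + 1 < e j
      · have h1 : v j (c + 1) = b ⟨j, ⟨c + 1, hc⟩⟩ := (hb j ⟨c + 1, hc⟩).symm
        rw [h1, Basis.repr_self]
        by_cases h : i = j
        · subst h
          simp [relMatrix, hr, Finsupp.single_apply, Fin.ext_iff, eq_comm]
        · simp [relMatrix, hr, h]
      · rw [hv j _ (by omega)]
        have : ¬ r (ε ⟨i, a⟩) (ε ⟨j, c⟩) := by
          rw [hr]
          rintro ⟨rfl : i = j, h : (a : ℕ) = c + 1⟩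
          omega
        simp [relMatrix, this]
  refine ⟨⟨s.toMatrix b', b'.toMatrix s, Basis.toMatrix_mul_toMatrix_flip _ _,
    Basis.toMatrix_mul_toMatrix_flip _ _⟩, fun p => μ (ε.symm p).1, r,
    isNilpotent_relMatrix (fun p => (ε.symm p).2) fun p q h => by omega, ?_, ?_⟩
  · rw [commute_diagonal_iff]
    intro p q h
    have : ¬ r p q := fun hr => h (by rw [hr.1])
    simp [relMatrix, this]
  · rw [← hmat]
    change g = s.toMatrix b' * _ * b'.toMatrix s
    rw [basis_toMatrix_mul_linearMap_toMatrix_mul_basis_toMatrix, LinearMap.toMatrix_eq_toMatrix',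
      LinearMap.toMatrix'_toLin']

end JordanForm

namespace IsZEquiv

variable {G : Type*} [Group G] {g h l : G}

theorem symm : IsZEquiv g h → IsZEquiv h g := by
  rintro ⟨a, ha⟩
  exact ⟨a⁻¹, fun x => by rw [ha]; group⟩

theorem trans : IsZEquiv g h → IsZEquiv h l → IsZEquiv g l := by
  rintro ⟨a, ha⟩ ⟨b, hb⟩
  exact ⟨b * a, fun x => by rw [ha, hb]; group⟩

theorem setOf_eq (H : IsZEquiv g h) : {x | IsZEquiv g x} = {x | IsZEquiv h x} :=
  Set.ext fun _ => ⟨H.symm.trans, H.trans⟩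

end IsZEquiv

/-- A matrix in `GL n k` can be rescaled to an element of `SL n k` when `k` is algebraically
closed. -/
theorem exists_smul_eq_coe_SL {k : Type*} [Field k] [IsAlgClosed k] {n : ℕ} (hn : 0 < n)
    (R : GL (Fin n) k) :
    ∃ (c : k) (a : Matrix.SpecialLinearGroup (Fin n) k), c ≠ 0 ∧ c • a.1 = R.1 := by
  have hdet : R.1.det ≠ 0 := R.det.ne_zero
  obtain ⟨c, hc⟩ := IsAlgClosed.exists_pow_nat_eq R.1.det hn
  have hc0 : c ≠ 0 := by
    rintro rfl
    rw [zero_pow hn.ne'] at hc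
    exact hdet hc.symm
  refine ⟨c, ⟨c⁻¹ • R.1, ?_⟩, hc0, ?_⟩
  · rw [Matrix.det_smul, Fintype.card_fin, ← hc, inv_pow, inv_mul_cancel₀ (pow_ne_zero n hc0)]
  · simp [hc0]

theorem Matrix.SpecialLinearGroup.mem_centralizer_singleton_iff {k : Type*} [Field k] {n : ℕ}
    (x g : Matrix.SpecialLinearGroup (Fin n) k) :
    x ∈ Subgroup.centralizer {g} ↔ Commute x.1 g.1 := by
  rw [Subgroup.mem_centralizer_singleton_iff, Commute, SemiconjBy,
    ← Matrix.SpecialLinearGroup.coe_mul, ← Matrix.SpecialLinearGroup.coe_mul]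
  exact Subtype.ext_iff

theorem commute_units_conj_iff {M : Type*} [Monoid M] (P : Mˣ) (x y : M) :
    Commute x (P * y * P⁻¹.val) ↔ Commute (P⁻¹.val * x * P) y := by
  have h1 : P⁻¹.val * x * P * y = P⁻¹.val * (x * (P * y * P⁻¹.val)) * P := by simp [mul_assoc]
  have h2 : y * (P⁻¹.val * x * P) = P⁻¹.val * (P * y * P⁻¹.val * x) * P := by simp [mul_assoc]
  rw [Commute, SemiconjBy, Commute, SemiconjBy, h1, h2, Units.mul_left_inj, Units.mul_right_inj]

/-- Two elements of `SL n k` with Jordan forms having the same nilpotent part and the same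
coincidences among the diagonal entries are z-equivalent. -/
theorem isZEquiv_of_jordan_form {k : Type*} [Field k] [IsAlgClosed k] {n : ℕ} (hn : 0 < n)
    {g h : Matrix.SpecialLinearGroup (Fin n) k} {P Q : GL (Fin n) k} {μ ν : Fin n → k}
    {N : Matrix (Fin n) (Fin n) k} (hN : IsNilpotent N)
    (hμ : Commute N (Matrix.diagonal μ)) (hν : Commute N (Matrix.diagonal ν))
    (hμν : ∀ p q, μ p = μ q ↔ ν p = ν q)
    (hg : g.1 = P.1 * (Matrix.diagonal μ + N) * P⁻¹.val)
    (hh : h.1 = Q.1 * (Matrix.diagonal ν + N) * Q⁻¹.val) : IsZEquiv g h := by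
  obtain ⟨c, a, hc, ha⟩ := exists_smul_eq_coe_SL hn (Q * P⁻¹)
  refine ⟨a, fun x => ?_⟩
  have hx : Q⁻¹.val * (a * x * a⁻¹).1 * Q.1 = P⁻¹.val * x.1 * P.1 := by
    have h1 : a.1 * x.1 = (a * x * a⁻¹).1 * a.1 := by
      rw [← Matrix.SpecialLinearGroup.coe_mul, ← Matrix.SpecialLinearGroup.coe_mul,
        inv_mul_cancel_right]
    have h2 : (Q * P⁻¹).1 * x.1 = (a * x * a⁻¹).1 * (Q * P⁻¹).1 := by
      rw [← ha, Matrix.smul_mul, Matrix.mul_smul, h1]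
    have h3 : (a * x * a⁻¹).1 * Q.1 = Q.1 * (P⁻¹.val * x.1 * P.1) := by
      simpa [mul_assoc] using congrArg (· * P.1) h2.symm
    rw [mul_assoc, h3, Units.inv_mul_cancel_left]
  simp only [Matrix.SpecialLinearGroup.mem_centralizer_singleton_iff]
  rw [hg, hh, commute_units_conj_iff, commute_units_conj_iff, hx, commute_diagonal_add_iff hN hμ,
    commute_diagonal_add_iff hN hν, commute_diagonal_iff, commute_diagonal_iff]
  simp only [Ne, hμν]

/-- Over an algebraically closed field `k`, the special linear group `SL n k` has only
finitely many z-classes. -/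
theorem finitely_many_zClasses_SL_of_isAlgClosed (k : Type*) [Field k] [IsAlgClosed k]
    (n : ℕ) (hn : 0 < n) :
    {C : Set (Matrix.SpecialLinearGroup (Fin n) k) |
      ∃ g : Matrix.SpecialLinearGroup (Fin n) k,
        C = {h : Matrix.SpecialLinearGroup (Fin n) k | IsZEquiv g h}}.Finite := by
  choose P μ r hN hc hg using fun g : Matrix.SpecialLinearGroup (Fin n) k => exists_jordan_form g.1
  let type (g : Matrix.SpecialLinearGroup (Fin n) k) :
      (Fin n → Fin n → Prop) × (Fin n → Fin n → Prop) := (r g, fun p q => μ g p = μ g q)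
  have hfactor : Function.FactorsThrough
      (fun g : Matrix.SpecialLinearGroup (Fin n) k => {h | IsZEquiv g h}) type := by
    intro g h hgh
    obtain ⟨hr, hμ⟩ := Prod.mk.inj hgh
    have hN' := hN h
    have hc' := hc h
    have hg' := hg h
    rw [← hr] at hc' hg'
    exact (isZEquiv_of_jordan_form hn (hN g) (hc g) hc'
      (fun p q => iff_of_eq (congrFun (congrFun hμ p) q)) (hg g) hg').setOf_eq
  refine (Set.finite_range (Function.extend type
    (fun g : Matrix.SpecialLinearGroup (Fin n) k => {h | IsZEquiv g h}) fun _ => ∅)).subset ?_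
  rintro C ⟨g, rfl⟩
  exact ⟨type g, hfactor.extend_apply _ g⟩
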